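/- Let Γ be a uniform graph (bounded local geometry). If Γ is Gromov hyperbolic and h(Γ) > 0, then Γ is an infinite graph with a pole, i.e., there exist a vertex v and M > 0 such that every point of Γ lies within distance M of some geodesic ray emanating from v. -/

import Mathlib

open Filter

/-- The vertex boundary of a finite set of vertices `A`: the vertices at graph
distance exactly 1 from `A`, i.e. outside `A` but adjacent to a vertex of `A`. -/
def vertexBoundary {V : Type*} (G : SimpleGraph V) (A : Finset V) : Set V :=
  {v | v ∉ A ∧ ∃ a ∈ A, G.Adj v a}

/-- The combinatorial Cheeger isoperimetric constant `h(Γ) = inf_A |∂A|/|A|`,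
where `A` ranges over all non-empty finite sets of vertices. -/
noncomputable def cheegerConst {V : Type*} (G : SimpleGraph V) : ℝ :=
  sInf { r : ℝ | ∃ A : Finset V, A.Nonempty ∧
    r = ((vertexBoundary G A).ncard : ℝ) / (A.card : ℝ) }

/-- A graph is `μ`-uniform if every vertex has at most `μ` neighbors. -/
def UniformGraph {V : Type*} (G : SimpleGraph V) (μ : ℕ) : Prop :=
  ∀ v : V, (G.neighborSet v).Finite ∧ (G.neighborSet v).ncard ≤ μ

/-- The Gromov product with respect to a base point, for the graph metric. -/
noncomputable def graphGromovProd {V : Type*} (G : SimpleGraph V) (o x y : V) : ℝ :=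
  ((G.dist x o : ℝ) + (G.dist y o : ℝ) - (G.dist x y : ℝ)) / 2

/-- A graph is Gromov hyperbolic if the Gromov products satisfy the
`δ`-inequality for some `δ ≥ 0`. -/
def GraphHyperbolic {V : Type*} (G : SimpleGraph V) : Prop :=
  ∃ δ : ℝ, 0 ≤ δ ∧ ∀ o x y z : V,
    min (graphGromovProd G o x z) (graphGromovProd G o z y) - δ ≤ graphGromovProd G o x y

/-- A geodesic ray in a graph, recorded through its consecutive vertices:
a sequence of vertices with `d(γ i, γ j) = |i - j|`. -/
def IsVertexRay {V : Type*} (G : SimpleGraph V) (γ : ℕ → V) : Prop :=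
  ∀ i j : ℕ, G.dist (γ i) (γ j) = max i j - min i j

/-- A graph has a pole in `v` if there is `M > 0` such that every vertex lies in
the `M`-neighborhood of some geodesic ray emanating from `v`. -/
def HasPole {V : Type*} (G : SimpleGraph V) : Prop :=
  ∃ (v : V) (M : ℝ), 0 < M ∧ ∀ w : V, ∃ γ : ℕ → V,
    IsVertexRay G γ ∧ γ 0 = v ∧ ∃ n : ℕ, (G.dist w (γ n) : ℝ) ≤ M

namespace SimpleGraph

variable {V : Type*} {G : SimpleGraph V}

/-- A geodesic from `x` to `y` contains a vertex at each distance `n ≤ d(x, y)` from `x`. -/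
theorem Connected.exists_dist_eq (hG : G.Connected) {x y : V} {n : ℕ} (hn : n ≤ G.dist x y) :
    ∃ w, G.dist x w = n ∧ G.dist w y = G.dist x y - n := by
  obtain ⟨p, hp⟩ := hG.exists_walk_length_eq_dist x y
  refine ⟨p.getVert n, ?_⟩
  have h1 := dist_le (p.take n)
  have h2 := dist_le (p.drop n)
  have h3 := hG.dist_triangle (u := x) (v := p.getVert n) (w := y)
  rw [Walk.take_length] at h1
  rw [Walk.drop_length] at h2
  omega

theorem Connected.exists_finset_ball_subset (hG : G.Connected) {μ : ℕ} (hμ : UniformGraph G μ)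
    (w : V) (n : ℕ) : ∃ F : Finset V, (∀ y, G.dist w y ≤ n → y ∈ F) ∧ F.card ≤ (μ + 1) ^ n := by
  classical
  induction n with
  | zero =>
    refine ⟨{w}, fun y hy => ?_, by simp⟩
    have := hG.dist_eq_zero_iff.1 (Nat.le_zero.1 hy)
    simp [this]
  | succ n ih =>
    obtain ⟨F, hF, hc⟩ := ih
    refine ⟨F.biUnion fun u => insert u (hμ u).1.toFinset, fun y hy => ?_, ?_⟩
    · rw [Finset.mem_biUnion]
      rcases Nat.lt_or_ge n (G.dist w y) with h | h
      · obtain ⟨u, hu, huy⟩ := hG.exists_dist_eq h.le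
        refine ⟨u, hF u hu.le, ?_⟩
        have : G.Adj u y := dist_eq_one_iff_adj.1 (by omega)
        simp [this]
      · exact ⟨y, hF y h, by simp⟩
    · refine (Finset.card_biUnion_le_card_mul _ _ (μ + 1) fun u _ => ?_).trans ?_
      · refine (Finset.card_insert_le _ _).trans ?_
        have := (hμ u).2
        rw [Set.ncard_eq_toFinset_card _ (hμ u).1] at this
        omega
      · rw [pow_succ]
        exact Nat.mul_le_mul_right _ hc

theorem cheegerConst_mul_card_le {A : Finset V} (hA : A.Nonempty) :
    cheegerConst G * A.card ≤ (vertexBoundary G A).ncard := by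
  have hpos : (0 : ℝ) < A.card := by exact_mod_cast hA.card_pos
  rw [← le_div_iff₀ hpos]
  refine csInf_le ⟨0, ?_⟩ ⟨A, hA, rfl⟩
  rintro r ⟨B, -, rfl⟩
  positivity

theorem infinite_of_cheegerConst_pos [Nonempty V] (h : 0 < cheegerConst G) : Infinite V := by
  by_contra hfin
  rw [not_infinite_iff_finite] at hfin
  have := Fintype.ofFinite V
  have h1 := cheegerConst_mul_card_le (G := G) (Finset.univ_nonempty (α := V))
  have h2 : vertexBoundary G Finset.univ = ∅ := by ext; simp [vertexBoundary]
  have h3 : (0 : ℝ) < (Finset.univ : Finset V).card := by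
    exact_mod_cast Finset.univ_nonempty.card_pos
  rw [h2, Set.ncard_empty, Nat.cast_zero] at h1
  nlinarith [mul_pos h h3]

/-- Twice the Gromov product of `x` and `y` based at `o`, as an integer. -/
noncomputable def doubleGromovProd (G : SimpleGraph V) (o x y : V) : ℤ :=
  G.dist o x + G.dist o y - G.dist x y

/-- The `δ`-inequality for the doubled Gromov products based at `o`. -/
def HyperbolicAt (G : SimpleGraph V) (o : V) (D : ℕ) : Prop :=
  ∀ x y z, min (G.doubleGromovProd o x z) (G.doubleGromovProd o z y) - D ≤
    G.doubleGromovProd o x y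

/-- The shadow of `x` seen from `o`: the vertices whose doubled Gromov product with `x` is
within `r` of the largest possible value. -/
def shadow (G : SimpleGraph V) (o x : V) (r : ℕ) : Set V :=
  {y | 2 * (G.dist o x : ℤ) - r ≤ G.doubleGromovProd o x y}

theorem _root_.GraphHyperbolic.exists_hyperbolicAt (h : GraphHyperbolic G) :
    ∃ D : ℕ, 0 < D ∧ ∀ o, G.HyperbolicAt o D := by
  obtain ⟨δ, -, h⟩ := h
  refine ⟨⌈2 * δ⌉₊ + 1, by omega, fun o x y z => ?_⟩
  have h1 := h o x y z
  have h2 := Nat.le_ceil (2 * δ)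
  have key : ∀ a b, graphGromovProd G o a b = (G.doubleGromovProd o a b : ℝ) / 2 := by
    intro a b
    simp [graphGromovProd, doubleGromovProd, dist_comm (v := o)]
  rw [key, key, key, min_div_div_right (by norm_num : (0 : ℝ) ≤ 2)] at h1
  have : ((min (G.doubleGromovProd o x z) (G.doubleGromovProd o z y) - (⌈2 * δ⌉₊ + 1 : ℕ) : ℤ) : ℝ)
      ≤ (G.doubleGromovProd o x y : ℝ) := by
    push_cast
    linarith
  exact_mod_cast this

theorem self_mem_shadow (o x : V) (r : ℕ) : x ∈ G.shadow o x r := by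
  simp only [shadow, doubleGromovProd, Set.mem_ofPred_eq, dist_self]
  omega

theorem shadow_mono (o x : V) {r s : ℕ} (h : r ≤ s) : G.shadow o x r ⊆ G.shadow o x s := by
  intro y hy
  simp only [shadow, Set.mem_ofPred_eq] at hy ⊢
  omega

theorem Connected.lt_of_shadow_finite [Infinite V] (hG : G.Connected) {o x : V} {r : ℕ}
    (h : (G.shadow o x r).Finite) : r < 2 * G.dist o x := by
  by_contra! hr
  refine Set.infinite_univ (α := V) (h.subset fun y _ => ?_)
  have := hG.dist_triangle (u := x) (v := o) (w := y)
  rw [dist_comm (u := x) (v := o)] at this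
  simp only [shadow, doubleGromovProd, Set.mem_ofPred_eq]
  omega

/-- If the vertex `y` in the shadow of `x` lies sufficiently farther from `o` than `x`,
then the larger shadow of `y` is contained in that of `x`. -/
theorem HyperbolicAt.shadow_subset {o : V} {D : ℕ} (hD : G.HyperbolicAt o D) {x y : V} {r : ℕ}
    (hy : y ∈ G.shadow o x r) (hxy : G.dist o x + D ≤ G.dist o y) :
    G.shadow o y (r + D) ⊆ G.shadow o x (r + D) := by
  intro z hz
  have := hD x z y
  simp only [shadow, Set.mem_ofPred_eq] at hy hz ⊢
  omega

/-- A finite shadow contains a vertex whose own shadow is finite and shallow. -/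
theorem HyperbolicAt.exists_shallow_shadow {o : V} {D : ℕ} (hD0 : 0 < D)
    (hD : G.HyperbolicAt o D) {x₀ : V} {r : ℕ} (hfin : (G.shadow o x₀ (r + D)).Finite) :
    ∃ x, (G.shadow o x r).Finite ∧ ∀ y ∈ G.shadow o x r, G.dist o y < G.dist o x + D := by
  have hX : {x | G.shadow o x (r + D) ⊆ G.shadow o x₀ (r + D)}.Finite :=
    hfin.subset fun x hx => hx (self_mem_shadow o x _)
  obtain ⟨x, hx, hmax⟩ := Set.exists_max_image _ (G.dist o) hX ⟨x₀, Set.Subset.refl _⟩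
  refine ⟨x, (hfin.subset hx).subset (shadow_mono o x (by omega)), fun y hy => ?_⟩
  by_contra! hlt
  have := hmax y ((hD.shadow_subset hy hlt).trans hx)
  omega

/-- The vertices of `B` together with all vertices whose doubled Gromov product with
some vertex of `B` is at least `p`. -/
def gromovNhd (G : SimpleGraph V) (o : V) (p : ℤ) (B : Set V) : Set V :=
  B ∪ {y | ∃ z ∈ B, p ≤ G.doubleGromovProd o z y}

theorem monotone_iterate_gromovNhd (o : V) (p : ℤ) (B : Set V) :
    Monotone fun i => (G.gromovNhd o p)^[i] B := by
  refine monotone_nat_of_le_succ fun i => ?_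
  rw [Function.iterate_succ_apply']
  exact Set.subset_union_left

/-- Along a chain of length `2 ^ q` the Gromov product drops only linearly in `q`. -/
theorem HyperbolicAt.exists_of_mem_iterate {o : V} {D : ℕ} (hD : G.HyperbolicAt o D) (p : ℤ)
    (q : ℕ) : ∀ (B : Set V) (y : V), y ∈ (G.gromovNhd o p)^[2 ^ q] B →
      ∃ z ∈ B, z = y ∨ p - D * q ≤ G.doubleGromovProd o z y := by
  induction q with
  | zero =>
    rintro B y (hy | ⟨z, hz, h⟩)
    · exact ⟨y, hy, .inl rfl⟩
    · exact ⟨z, hz, .inr (by simpa using h)⟩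
  | succ q ih =>
    intro B y hy
    rw [pow_succ, mul_two, Function.iterate_add_apply] at hy
    obtain ⟨u, hu, h1⟩ := ih _ _ hy
    obtain ⟨z, hz, h2⟩ := ih _ _ hu
    refine ⟨z, hz, ?_⟩
    have h3 := hD z y u
    push_cast
    have h4 : (D : ℤ) * (q + 1) = D * q + D := by ring
    rw [h4]
    rcases h1 with rfl | h1 <;> rcases h2 with rfl | h2
    · exact .inl rfl
    · right; omega
    · right; omega
    · right; omega

section Shallow

variable {o x : V} {D μ : ℕ}

theorem HyperbolicAt.iterate_gromovNhd_subset_shadow (hD : G.HyperbolicAt o D) {j q i : ℕ}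
    (hi : i ≤ 2 ^ q) :
    (G.gromovNhd o (2 * G.dist o x - 2 * j + D * q))^[i] (G.shadow o x (2 * j)) ⊆
      G.shadow o x (2 * j + D) := by
  intro y hy
  obtain ⟨z, hz, h⟩ := hD.exists_of_mem_iterate _ q _ y (monotone_iterate_gromovNhd o _ _ hi hy)
  rcases h with rfl | h
  · exact shadow_mono o x (by omega) hz
  · have := hD x y z
    simp only [shadow, Set.mem_ofPred_eq] at hz ⊢
    push_cast at hz ⊢
    omega

/-- A vertex `y` in the shadow of `x` is close to the vertex `w` at distance `j` from `x` on a
geodesic to `o`. -/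
theorem HyperbolicAt.dist_le_of_mem_shadow (hD : G.HyperbolicAt o D) {w y : V} {j r : ℕ}
    (hj : j ≤ G.dist o x) (hw : G.dist o w = G.dist o x - j) (hwx : G.dist w x = j)
    (hy : y ∈ G.shadow o x (2 * j + r)) :
    (G.dist w y : ℤ) ≤ G.dist o y - G.dist o w + r + D := by
  have := hD w y x
  simp only [shadow, doubleGromovProd, Set.mem_ofPred_eq] at hy this
  push_cast at hy
  omega

theorem HyperbolicAt.card_shadow_le (hG : G.Connected) (hμ : UniformGraph G μ)
    (hD : G.HyperbolicAt o D) {j : ℕ} (hj : j ≤ G.dist o x)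
    (hlev : ∀ y ∈ G.shadow o x (2 * j), G.dist o y < G.dist o x + D) :
    (G.shadow o x (2 * j)).ncard ≤ (μ + 1) ^ (j + 2 * D) := by
  obtain ⟨w, hw, hwx⟩ := hG.exists_dist_eq (x := o) (y := x) (Nat.sub_le _ j)
  obtain ⟨F, hF, hc⟩ := hG.exists_finset_ball_subset hμ w (j + 2 * D)
  refine le_trans ?_ hc
  rw [← Set.ncard_coe_finset]
  refine Set.ncard_le_ncard (fun y hy => hF y ?_) F.finite_toSet
  have := hD.dist_le_of_mem_shadow (r := 0) hj hw (by omega) hy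
  have := hlev y hy
  omega

theorem le_card_shadow (hG : G.Connected) {j : ℕ} (hj : j ≤ G.dist o x)
    (hfin : (G.shadow o x (2 * j)).Finite) : j ≤ (G.shadow o x (2 * j)).ncard := by
  have h : ((Finset.Ioc (G.dist o x - j) (G.dist o x) : Finset ℕ) : Set ℕ) ⊆
      G.dist o '' G.shadow o x (2 * j) := by
    intro n hn
    rw [Finset.mem_coe, Finset.mem_Ioc] at hn
    obtain ⟨w, hw, hwx⟩ := hG.exists_dist_eq hn.2
    refine ⟨w, ?_, hw⟩
    simp only [shadow, doubleGromovProd, Set.mem_ofPred_eq, dist_comm (u := x)]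
    push_cast
    omega
  have h1 := Set.ncard_le_ncard h (hfin.image _)
  rw [Set.ncard_coe_finset, Nat.card_Ioc] at h1
  have h2 := Set.ncard_image_le (f := G.dist o) hfin
  omega

/-- Enlarging a finite shadow by a bounded amount multiplies its cardinality by an arbitrarily
large factor, up to an additive error that does not depend on the shadow. -/
theorem HyperbolicAt.cheegerConst_mul_card_shadow_le (hG : G.Connected) (hμ : UniformGraph G μ)
    (hD : G.HyperbolicAt o D) {j : ℕ} (q : ℕ) (hj : j ≤ G.dist o x)
    (hfin : (G.shadow o x (2 * j + D)).Finite) :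
    2 ^ q * (cheegerConst G * (G.shadow o x (2 * j)).ncard) ≤
      (G.shadow o x (2 * j + D)).ncard + 2 ^ q * ((μ + 1 : ℝ) ^ (D * q + 2 * D + 3)) := by
  classical
  set p : ℤ := 2 * G.dist o x - 2 * j + D * q with hp
  set B : ℕ → Set V := fun i => (G.gromovNhd o p)^[i] (G.shadow o x (2 * j)) with hB
  have hBmono : Monotone B := monotone_iterate_gromovNhd o p _
  have hBsub : ∀ i ≤ 2 ^ q, B i ⊆ G.shadow o x (2 * j + D) := fun i hi =>
    hD.iterate_gromovNhd_subset_shadow hi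
  have hBfin : ∀ i ≤ 2 ^ q, (B i).Finite := fun i hi => hfin.subset (hBsub i hi)
  obtain ⟨w, hw, hwx⟩ := hG.exists_dist_eq (x := o) (y := x) (Nat.sub_le _ j)
  obtain ⟨F, hF, hc⟩ := hG.exists_finset_ball_subset hμ w (D * q + 2 * D + 3)
  have hcheeger : 0 ≤ cheegerConst G := by
    refine Real.sInf_nonneg ?_
    rintro r ⟨A, -, rfl⟩
    positivity
  have step : ∀ i < 2 ^ q, cheegerConst G * (G.shadow o x (2 * j)).ncard ≤
      (((B (i + 1)).ncard : ℝ) - (B i).ncard) + (μ + 1 : ℝ) ^ (D * q + 2 * D + 3) := by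
    intro i hi
    have hfi := hBfin i hi.le
    have hfs := hBfin (i + 1) hi
    have hsub0 : G.shadow o x (2 * j) ⊆ B i := hBmono (Nat.zero_le i)
    have hne : hfi.toFinset.Nonempty := by
      rw [Set.Finite.toFinset_nonempty]
      exact ⟨x, hsub0 (self_mem_shadow o x _)⟩
    have h1 := cheegerConst_mul_card_le (G := G) hne
    rw [← Set.ncard_eq_toFinset_card _ hfi] at h1
    have h2 : vertexBoundary G hfi.toFinset ⊆ (B (i + 1) \ B i) ∪ F := by
      rintro y ⟨hy, z, hz, hyz⟩
      rw [Set.Finite.mem_toFinset] at hy hz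
      have hzy : G.dist z y = 1 := dist_eq_one_iff_adj.2 hyz.symm
      have t1 := hG.dist_triangle (u := o) (v := z) (w := y)
      have t2 := hG.dist_triangle (u := o) (v := y) (w := z)
      have t3 := hG.dist_triangle (u := x) (v := z) (w := y)
      rw [dist_comm (u := y)] at t2
      by_cases hdeep : p ≤ G.doubleGromovProd o z y
      · refine .inl ⟨?_, hy⟩
        simp only [hB, Function.iterate_succ_apply']
        exact .inr ⟨z, hz, hdeep⟩
      · refine .inr (hF y ?_)
        have hzS := hBsub i hi.le hz
        have hyS : y ∈ G.shadow o x (2 * j + (D + 2)) := by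
          simp only [shadow, doubleGromovProd, Set.mem_ofPred_eq] at hzS ⊢
          push_cast at hzS ⊢
          omega
        have h3 := hD.dist_le_of_mem_shadow hj hw (by omega) hyS
        simp only [doubleGromovProd, hp] at hdeep
        have h4 : (0 : ℤ) ≤ D * q := by positivity
        zify
        push_cast at h3
        omega
    have h3 := (Set.ncard_le_ncard h2 (hfs.sdiff.union F.finite_toSet)).trans
      (Set.ncard_union_le _ _)
    have h4 := Set.ncard_sdiff_add_ncard_of_subset (hBmono (Nat.le_succ i)) hfs
    have h5 := Set.ncard_le_ncard hsub0 hfi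
    rw [Set.ncard_coe_finset] at h3
    have h6 : ((vertexBoundary G hfi.toFinset).ncard : ℝ) + (B i).ncard ≤
        (B (i + 1)).ncard + (μ + 1 : ℝ) ^ (D * q + 2 * D + 3) := by
      have : (vertexBoundary G hfi.toFinset).ncard + (B i).ncard ≤
        (B (i + 1)).ncard + (μ + 1) ^ (D * q + 2 * D + 3) := by
        simp only [Nat.succ_eq_add_one] at h4
        omega
      exact_mod_cast this
    have h7 : cheegerConst G * (G.shadow o x (2 * j)).ncard ≤ cheegerConst G * (B i).ncard :=
      mul_le_mul_of_nonneg_left (by exact_mod_cast h5) hcheeger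
    linarith
  have hsum := Finset.sum_le_sum fun i hi => step i (Finset.mem_range.1 hi)
  rw [Finset.sum_add_distrib, Finset.sum_range_sub (fun i => ((B i).ncard : ℝ))] at hsum
  simp only [Finset.sum_const, Finset.card_range, nsmul_eq_mul, Nat.cast_pow,
    Nat.cast_ofNat] at hsum
  have hlast : ((B (2 ^ q)).ncard : ℝ) ≤ (G.shadow o x (2 * j + D)).ncard := by
    exact_mod_cast Set.ncard_le_ncard (hBsub _ le_rfl) hfin
  have hfirst : (0 : ℝ) ≤ (B 0).ncard := by positivity
  linarith

end Shallow

/-- In a uniform hyperbolic graph with positive Cheeger constant, all shadows of some fixed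
size are infinite. -/
theorem HyperbolicAt.exists_forall_shadow_infinite [Infinite V] (hG : G.Connected) {μ : ℕ}
    (hμ : UniformGraph G μ) (h : 0 < cheegerConst G) {o : V} {D : ℕ} (hD0 : 0 < D)
    (hD : G.HyperbolicAt o D) : ∃ r : ℕ, ∀ x, (G.shadow o x r).Infinite := by
  set c := cheegerConst G
  set E : ℝ := (μ + 1 : ℝ) ^ D with hE
  have hE0 : 0 < E := by positivity
  obtain ⟨q, hq⟩ := pow_unbounded_of_one_lt (4 * E / c) (one_lt_two (α := ℝ))
  rw [div_lt_iff₀ h] at hq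
  set N : ℝ := (μ + 1 : ℝ) ^ (D * q + 2 * D + 3)
  obtain ⟨a, ha⟩ := exists_nat_gt (2 * N / c)
  rw [div_lt_iff₀ h] at ha
  obtain ⟨k, hk⟩ := pow_unbounded_of_one_lt (E ^ (a + 2)) (one_lt_two (α := ℝ))
  refine ⟨2 * (D * (a + k + 1)) + D, fun x₀ hx₀ => ?_⟩
  obtain ⟨x, hfin, hlev⟩ := hD.exists_shallow_shadow hD0 hx₀
  have hlt := hG.lt_of_shadow_finite hfin
  have hle : ∀ t ≤ a + k + 1, D * t ≤ D * (a + k + 1) := fun t ht => Nat.mul_le_mul_left _ ht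
  have hsub : ∀ t ≤ a + k + 1,
      G.shadow o x (2 * (D * t)) ⊆ G.shadow o x (2 * (D * (a + k + 1))) := fun t ht =>
    shadow_mono o x (by have := hle t ht; omega)
  have hgrow : ∀ i ≤ k, (2 * E) ^ i ≤ (G.shadow o x (2 * (D * (a + i)))).ncard := by
    intro i
    induction i with
    | zero =>
      intro _
      rw [pow_zero, Nat.one_le_cast, Nat.one_le_iff_ne_zero, ← Nat.pos_iff_ne_zero,
        Set.ncard_pos (hfin.subset (hsub _ (by omega)))]
      exact ⟨x, self_mem_shadow o x _⟩
    | succ i ih =>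
      intro hi
      have h1 := ih (by omega)
      have hsucc : 2 * (D * (a + i)) + D ≤ 2 * (D * (a + (i + 1))) := by
        rw [← add_assoc, mul_add D (a + i) 1]; omega
      have hfin' := hfin.subset (hsub (a + (i + 1)) (by omega))
      have hj : D * (a + i) ≤ G.dist o x := by
        have := hle (a + i) (by omega)
        omega
      have h2 := hD.cheegerConst_mul_card_shadow_le hG hμ q hj
        (hfin'.subset (shadow_mono o x hsucc))
      have h3 : ((G.shadow o x (2 * (D * (a + i)) + D)).ncard : ℝ) ≤
          (G.shadow o x (2 * (D * (a + (i + 1))))).ncard := by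
        exact_mod_cast Set.ncard_le_ncard (shadow_mono o x hsucc) hfin'
      have h4 := le_card_shadow hG hj (hfin.subset (hsub (a + i) (by omega)))
      have h5 : (a : ℝ) ≤ (G.shadow o x (2 * (D * (a + i)))).ncard := by
        have : a ≤ D * (a + i) := by nlinarith
        exact_mod_cast this.trans h4
      set s : ℝ := ((G.shadow o x (2 * (D * (a + i)))).ncard : ℝ)
      have h6 : 2 * N ≤ c * s := by nlinarith
      have h7 : (0 : ℝ) < 2 ^ q := by positivity
      have h8 : (2 : ℝ) ^ q * (2 * N) ≤ 2 ^ q * (c * s) := mul_le_mul_of_nonneg_left h6 h7.le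
      have h9 : 4 * E * s ≤ 2 ^ q * c * s := mul_le_mul_of_nonneg_right hq.le (by positivity)
      have h10 : 2 * E * (2 * E) ^ i ≤ 2 * E * s := mul_le_mul_of_nonneg_left h1 (by positivity)
      rw [pow_succ']
      linarith
  have h1 := hgrow k le_rfl
  have hj : D * (a + k) ≤ G.dist o x := by
    have := hle (a + k) (by omega)
    omega
  have h2 := hD.card_shadow_le hG hμ hj fun y hy => hlev y (hsub _ (by omega) hy)
  have h3 : ((G.shadow o x (2 * (D * (a + k)))).ncard : ℝ) ≤ E ^ (a + 2) * E ^ k := by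
    rw [← pow_add, hE, ← pow_mul]
    have h4 : D * (a + 2 + k) = D * (a + k) + 2 * D := by ring
    rw [h4]
    exact_mod_cast h2
  rw [mul_pow] at h1
  nlinarith [pow_pos hE0 k]

/-- The vertices `z` such that some geodesic from `o` to `z` passes through `v`. -/
def descendants (G : SimpleGraph V) (o v : V) : Set V :=
  {z | G.dist o z = G.dist o v + G.dist v z}

theorem Connected.exists_adj_descendants_infinite (hG : G.Connected) {o v : V}
    (hv : (G.neighborSet v).Finite) {S : Set V} (hS : (G.descendants o v ∩ S).Infinite) :
    ∃ u, G.Adj v u ∧ G.dist o u = G.dist o v + 1 ∧ (G.descendants o u ∩ S).Infinite := by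
  by_contra! hno
  refine hS (((Set.finite_singleton v).union ((hv.subset (Set.sep_subset _
    fun u => G.dist o u = G.dist o v + 1)).biUnion fun u hu =>
      hno u hu.1 hu.2)).subset ?_)
  rintro z ⟨hz, hzS⟩
  rw [descendants, Set.mem_ofPred_eq] at hz
  rcases Nat.eq_zero_or_pos (G.dist v z) with h0 | hpos
  · exact .inl (hG.dist_eq_zero_iff.1 h0).symm
  · obtain ⟨u, hvu, huz⟩ := hG.exists_dist_eq hpos
    have t1 := hG.dist_triangle (u := o) (v := v) (w := u)
    have t2 := hG.dist_triangle (u := o) (v := u) (w := z)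
    have hu : G.dist o u = G.dist o v + 1 := by omega
    refine .inr (Set.mem_biUnion (x := u) ⟨dist_eq_one_iff_adj.1 hvu, hu⟩ ⟨?_, hzS⟩)
    rw [descendants, Set.mem_ofPred_eq]
    omega

theorem Connected.isVertexRay (hG : G.Connected) {γ : ℕ → V}
    (hadj : ∀ n, G.Adj (γ n) (γ (n + 1))) (hlev : ∀ n, G.dist (γ 0) (γ n) = n) :
    IsVertexRay G γ := by
  have hle : ∀ i k, G.dist (γ i) (γ (i + k)) ≤ k := by
    intro i k
    induction k with
    | zero => simp
    | succ k ih =>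
      have h1 := hG.dist_triangle (u := γ i) (v := γ (i + k)) (w := γ (i + k + 1))
      have h2 := dist_eq_one_iff_adj.2 (hadj (i + k))
      rw [← add_assoc]
      omega
  have heq : ∀ i k, G.dist (γ i) (γ (i + k)) = k := by
    intro i k
    have h1 := hG.dist_triangle (u := γ 0) (v := γ i) (w := γ (i + k))
    have := hle i k
    rw [hlev, hlev] at h1
    omega
  intro i j
  rcases le_total i j with hij | hij
  · obtain ⟨k, rfl⟩ := Nat.exists_eq_add_of_le hij
    rw [heq]
    omega
  · obtain ⟨k, rfl⟩ := Nat.exists_eq_add_of_le hij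
    rw [dist_comm, heq]
    omega

/-- Every infinite set of vertices of a locally finite connected graph is shadowed by a
geodesic ray from `o`. -/
theorem Connected.exists_isVertexRay (hG : G.Connected) (hfin : ∀ v, (G.neighborSet v).Finite)
    (o : V) {S : Set V} (hS : S.Infinite) :
    ∃ γ : ℕ → V, IsVertexRay G γ ∧ γ 0 = o ∧ ∀ n, (G.descendants o (γ n) ∩ S).Infinite := by
  choose f hadj hlev hinf using fun v : {v // (G.descendants o v ∩ S).Infinite} =>
    hG.exists_adj_descendants_infinite (hfin v) v.2
  have ho : (G.descendants o o ∩ S).Infinite := by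
    simpa [descendants] using hS
  let F : {v // (G.descendants o v ∩ S).Infinite} → {v // (G.descendants o v ∩ S).Infinite} :=
    fun v => ⟨f v, hinf v⟩
  have hF : ∀ n, (F^[n + 1] ⟨o, ho⟩ : V) = f (F^[n] ⟨o, ho⟩) := fun n => by
    rw [Function.iterate_succ_apply']
  refine ⟨fun n => F^[n] ⟨o, ho⟩, hG.isVertexRay (fun n => ?_) fun n => ?_, rfl,
    fun n => (F^[n] ⟨o, ho⟩).2⟩
  · rw [hF]
    exact hadj _
  · induction n with
    | zero => exact dist_self
    | succ n ih =>
      rw [hF]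
      exact (hlev _).trans (congrArg (· + 1) ih)

/-- If the shadow of `x` is infinite, then some geodesic ray from `o` passes close to `x`. -/
theorem HyperbolicAt.exists_isVertexRay (hG : G.Connected)
    (hfin : ∀ v, (G.neighborSet v).Finite) {o : V} {D : ℕ} (hD : G.HyperbolicAt o D) {x : V}
    {r : ℕ} (hS : (G.shadow o x r).Infinite) :
    ∃ γ : ℕ → V, IsVertexRay G γ ∧ γ 0 = o ∧ ∃ n, G.dist x (γ n) ≤ r + D := by
  obtain ⟨γ, hγ, h0, hinf⟩ := hG.exists_isVertexRay hfin o hS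
  refine ⟨γ, hγ, h0, G.dist o x - r, ?_⟩
  obtain ⟨z, hz, hzS⟩ := (hinf (G.dist o x - r)).nonempty
  have hlev : G.dist o (γ (G.dist o x - r)) = G.dist o x - r := by
    rw [← h0, hγ]
    omega
  have h1 := hD x (γ (G.dist o x - r)) z
  have h2 := hG.dist_triangle (u := x) (v := o) (w := γ (G.dist o x - r))
  rw [dist_comm (u := x) (v := o)] at h2
  simp only [shadow, descendants, doubleGromovProd, Set.mem_ofPred_eq] at hz hzS h1
  rw [dist_comm (u := z)] at h1
  omega

end SimpleGraph

/-- A uniform hyperbolic graph with positive Cheeger constant is an infinite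
graph with a pole. -/
theorem infinite_and_pole_of_cheeger_pos {V : Type*} (G : SimpleGraph V)
    (hconn : G.Connected) (μ : ℕ) (hμ : UniformGraph G μ)
    (hhyp : GraphHyperbolic G) (h : 0 < cheegerConst G) :
    Infinite V ∧ HasPole G := by
  have := hconn.nonempty
  have hinf := SimpleGraph.infinite_of_cheegerConst_pos h
  obtain ⟨D, hD0, hD⟩ := hhyp.exists_hyperbolicAt
  obtain ⟨o⟩ := this
  obtain ⟨r, hr⟩ := (hD o).exists_forall_shadow_infinite hconn hμ h hD0
  refine ⟨hinf, o, (r + D : ℕ), by exact_mod_cast Nat.add_pos_right r hD0, fun w => ?_⟩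
  obtain ⟨γ, hγ, h0, n, hn⟩ := (hD o).exists_isVertexRay hconn (fun v => (hμ v).1) (hr w)
  exact ⟨γ, hγ, h0, n, by exact_mod_cast hn⟩
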